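/- Let G = G_1 * G_2 * ... * G_n * F be a free product where each factor G_i is not infinite cyclic and F is a free group of finite rank, and let φ: G → G be a symmetric monomorphism of G. Then the stable image φ^∞(G) = ⋂_{k=1}^{∞} φ^k(G) has Kurosh rank at most n + rank(F) with respect to this free product decomposition of G. -/

import Mathlib

universe u

open Monoid

instance sumElimGroup {α β : Type*} (A : α → Type u) (B : β → Type u)
    [∀ a, Group (A a)] [∀ b, Group (B b)] (x : α ⊕ β) : Group (Sum.elim A B x) :=
  match x with
  | .inl a => inferInstanceAs (Group (A a))
  | .inr b => inferInstanceAs (Group (B b))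

/-- The free factor `G_i` of a free product, viewed as a subgroup. -/
def factorSubgroup {ι : Type*} {M : ι → Type*} [∀ i, Group (M i)] (i : ι) :
    Subgroup (CoprodI M) := (CoprodI.of (i := i)).range

/-- The conjugate `g S g⁻¹` of a subgroup `S`. -/
def conjSubgroup {G : Type*} [Group G] (g : G) (S : Subgroup G) : Subgroup G :=
  S.map (MulAut.conj g).toMonoidHom

/-- The `n`-th iterate of an endomorphism. -/
def iterHom {G : Type*} [Group G] (φ : G →* G) : ℕ → (G →* G)
  | 0 => MonoidHom.id G
  | n + 1 => φ.comp (iterHom φ n)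

/-- The stable image `φ^∞(G) = ⋂ₙ φⁿ(G)`. -/
def stableImage {G : Type*} [Group G] (φ : G →* G) : Subgroup G :=
  ⨅ n : ℕ, (iterHom φ (n + 1)).range

/-- The fixed subgroup of an endomorphism. -/
def fixedSubgroup {G : Type*} [Group G] (φ : G →* G) : Subgroup G where
  carrier := {g | φ g = g}
  one_mem' := by simp
  mul_mem' := by intro a b ha hb; simp only [Set.mem_setOf_eq, map_mul] at *; rw [ha, hb]
  inv_mem' := by intro a ha; simp only [Set.mem_setOf_eq, map_inv] at *; rw [ha]

/-- `H` has Kurosh rank at most `k` with respect to the given splitting. -/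
def HasKuroshRankLE {ι : Type} {M : ι → Type} [∀ i, Group (M i)]
    (H : Subgroup (CoprodI M)) (k : ℕ) : Prop :=
  ∃ (m r : ℕ) (J : Fin m → ι) (g : Fin m → CoprodI M)
    (e : H ≃* CoprodI (Sum.elim
      (fun i : Fin m => ↥(conjSubgroup (g i) (factorSubgroup (J i)) ⊓ H))
      (fun _ : Fin r => Multiplicative ℤ))),
    m + r ≤ k ∧
    (∀ i : Fin m, Nontrivial ↥(conjSubgroup (g i) (factorSubgroup (J i)) ⊓ H)) ∧
    ∀ (i : Fin m) (x : ↥(conjSubgroup (g i) (factorSubgroup (J i)) ⊓ H)),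
      ((e.symm (CoprodI.of (i := Sum.inl i) x) : H) : CoprodI M) = (x : CoprodI M)

/-- A homomorphism between free products is *symmetric* if each non-infinite-cyclic free
factor of the domain is mapped into a conjugate of some non-infinite-cyclic free factor of
the codomain. -/
def IsSymmetric {ι κ : Type} {M : ι → Type} {N : κ → Type}
    [∀ i, Group (M i)] [∀ j, Group (N j)]
    (φ : Monoid.CoprodI M →* Monoid.CoprodI N) : Prop :=
  ∀ i : ι, ¬ Nonempty (M i ≃* Multiplicative ℤ) →
    ∃ (j : κ) (g : Monoid.CoprodI N), ¬ Nonempty (N j ≃* Multiplicative ℤ) ∧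
      (factorSubgroup i).map φ ≤ conjSubgroup g (factorSubgroup j)

namespace KuroshRank

variable {ι : Type} {M : ι → Type} [∀ i, Group (M i)]

/-- The coset of the identity. -/
abbrev root (H : Subgroup (CoprodI M)) : CoprodI M ⧸ H := ((1 : CoprodI M) : CoprodI M ⧸ H)

lemma smul_root_eq_root_iff {H : Subgroup (CoprodI M)} {g : CoprodI M} :
    g • root H = root H ↔ g ∈ H := by
  rw [root, MulAction.Quotient.smul_coe, QuotientGroup.eq]
  simp

lemma smul_root (H : Subgroup (CoprodI M)) (g : CoprodI M) :
    g • root H = (g : CoprodI M ⧸ H) := by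
  rw [root, MulAction.Quotient.smul_coe, smul_eq_mul, mul_one]

/-- A rooted spanning tree in the quotient by `H` of the Bass-Serre tree of a free product.
The pairs `(c, i)` are the edges of this quotient graph; the orbit of `c` under the `i`-th factor
is represented by its point `base c i`, and `(c, parent c)` is the first edge of the tree path from
the coset `c` to the root. The element `path c` moves the root to `c` along the tree. -/
structure CosetTree (H : Subgroup (CoprodI M)) where
  base : CoprodI M ⧸ H → ι → CoprodI M ⧸ H
  shift : (CoprodI M ⧸ H) → (i : ι) → M i
  parent : CoprodI M ⧸ H → ι
  path : CoprodI M ⧸ H → CoprodI M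
  depth : CoprodI M ⧸ H → ℕ
  shift_smul : ∀ c i, (CoprodI.of (shift c i) : CoprodI M) • base c i = c
  base_smul : ∀ c i (m : M i), base ((CoprodI.of m : CoprodI M) • c) i = base c i
  shift_base : ∀ c i, base c i = c → shift c i = 1
  base_root : ∀ i, base (root H) i = root H
  path_smul : ∀ c, path c • root H = c
  path_root : path (root H) = 1
  path_eq : ∀ c, c ≠ root H → path c = CoprodI.of (shift c (parent c)) * path (base c (parent c))
  depth_lt : ∀ c, c ≠ root H → depth (base c (parent c)) < depth c

/-- The cosets reachable from the root by a product of `k` elements of the free factors. -/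
inductive Reachable (H : Subgroup (CoprodI M)) : ℕ → CoprodI M ⧸ H → Prop
  | root : Reachable H 0 (root H)
  | step {k : ℕ} {c : CoprodI M ⧸ H} {i : ι} (m : M i) (h : Reachable H k c) :
      Reachable H (k + 1) ((CoprodI.of m : CoprodI M) • c)

lemma exists_reachable (H : Subgroup (CoprodI M)) (c : CoprodI M ⧸ H) :
    ∃ k, Reachable H k c := by
  have key : ∀ (g : CoprodI M) (k : ℕ) (c : CoprodI M ⧸ H), Reachable H k c →
      ∃ k', Reachable H k' (g • c) := by
    intro g
    induction g using CoprodI.induction_on with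
    | one => intro k c h; exact ⟨k, by simpa using h⟩
    | of i m => intro k c h; exact ⟨k + 1, .step m h⟩
    | mul x y hx hy =>
      intro k c h
      obtain ⟨k', h'⟩ := hy k c h
      obtain ⟨k'', h''⟩ := hx k' _ h'
      exact ⟨k'', by rwa [mul_smul]⟩
  induction c using QuotientGroup.induction_on with
  | H g =>
    obtain ⟨k, h⟩ := key g 0 _ .root
    exact ⟨k, by rwa [smul_root] at h⟩

open Classical in
/-- The least number of factor elements needed to reach a coset. -/
noncomputable def cosetLength (H : Subgroup (CoprodI M)) (c : CoprodI M ⧸ H) : ℕ :=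
  Nat.find (exists_reachable H c)

lemma exists_cosetLength_lt {H : Subgroup (CoprodI M)} {c : CoprodI M ⧸ H} (hc : c ≠ root H) :
    ∃ (i : ι) (m : M i), cosetLength H ((CoprodI.of m : CoprodI M) • c) < cosetLength H c := by
  classical
  have h : Reachable H (cosetLength H c) c := Nat.find_spec (exists_reachable H c)
  generalize hk : cosetLength H c = k at h
  cases h with
  | root => exact absurd rfl hc
  | @step k c i m h =>
    refine ⟨i, m⁻¹, ?_⟩
    rw [map_inv, inv_smul_smul]
    exact Nat.lt_succ_of_le (Nat.find_min' _ h)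

lemma cosetLength_root (H : Subgroup (CoprodI M)) : cosetLength H (root H) = 0 := by
  classical
  exact Nat.le_zero.1 (Nat.find_min' _ .root)

lemma eq_root_of_cosetLength {H : Subgroup (CoprodI M)} {c : CoprodI M ⧸ H}
    (h : cosetLength H c = 0) : c = root H := by
  by_contra hc
  obtain ⟨i, m, h'⟩ := exists_cosetLength_lt hc
  omega

lemma exists_path {C G : Type*} [Group G] (depth : C → ℕ) (c₀ : C) (f : C → C) (g : C → G)
    (hf : ∀ c, c ≠ c₀ → depth (f c) < depth c) :
    ∃ τ : C → G, τ c₀ = 1 ∧ ∀ c, c ≠ c₀ → τ c = g c * τ (f c) := by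
  classical
  refine ⟨(measure depth).wf.fix
    (fun c ih => if h : c = c₀ then 1 else g c * ih (f c) (hf c h)), ?_, fun c hc => ?_⟩
  · rw [WellFounded.fix_eq, dif_pos rfl]
  · rw [WellFounded.fix_eq, dif_neg hc]

lemma nonempty_cosetTree [Nonempty ι] (H : Subgroup (CoprodI M)) : Nonempty (CosetTree H) := by
  classical
  let orb (c : CoprodI M ⧸ H) (i : ι) : Set (CoprodI M ⧸ H) :=
    Set.range fun m : M i => (CoprodI.of m : CoprodI M) • c
  have orb_smul : ∀ c i (m : M i), orb ((CoprodI.of m : CoprodI M) • c) i = orb c i := by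
    intro c i m
    ext x
    constructor
    · rintro ⟨m', rfl⟩
      exact ⟨m' * m, by simp [mul_smul]⟩
    · rintro ⟨m', rfl⟩
      exact ⟨m' * m⁻¹, by simp [mul_smul]⟩
  let pick (s : Set (CoprodI M ⧸ H)) : CoprodI M ⧸ H :=
    if h : s.Nonempty then Function.argminOn (cosetLength H) s h else root H
  have hne : ∀ c i, (orb c i).Nonempty := fun c i => Set.range_nonempty _
  have pick_mem : ∀ c i, pick (orb c i) ∈ orb c i := by
    intro c i
    simp only [pick, dif_pos (hne c i)]
    exact Function.argminOn_mem _ _ _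
  have pick_le : ∀ c i (m : M i),
      cosetLength H (pick (orb c i)) ≤ cosetLength H ((CoprodI.of m : CoprodI M) • c) := by
    intro c i m
    simp only [pick, dif_pos (hne c i)]
    exact Function.argminOn_le _ _ (Set.mem_range_self m)
  have hshift : ∀ c i, ∃ m : M i, (CoprodI.of m : CoprodI M) • pick (orb c i) = c ∧
      (pick (orb c i) = c → m = 1) := by
    intro c i
    by_cases h : pick (orb c i) = c
    · exact ⟨1, by simp [h], fun _ => rfl⟩
    · obtain ⟨m, hm⟩ := pick_mem c i
      exact ⟨m⁻¹, by rw [← hm, map_inv, inv_smul_smul], fun h' => absurd h' h⟩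
  choose shift shift_smul shift_base using hshift
  have hpar : ∀ c, ∃ i, c ≠ root H → cosetLength H (pick (orb c i)) < cosetLength H c := by
    intro c
    by_cases hc : c = root H
    · exact ⟨Classical.arbitrary ι, fun h => absurd hc h⟩
    · obtain ⟨i, m, h⟩ := exists_cosetLength_lt hc
      exact ⟨i, fun _ => (pick_le c i m).trans_lt h⟩
  choose par hpar using hpar
  obtain ⟨τ, τ_root, τ_eq⟩ := exists_path (cosetLength H) (root H)
    (fun c => pick (orb c (par c))) (fun c => (CoprodI.of (shift c (par c)) : CoprodI M)) hpar
  refine ⟨⟨fun c i => pick (orb c i), shift, par, τ, cosetLength H, shift_smul,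
    fun c i m => congrArg pick (orb_smul c i m), shift_base, fun i => ?_, fun c => ?_, τ_root, τ_eq,
    hpar⟩⟩
  · apply eq_root_of_cosetLength
    have := pick_le (root H) i 1
    rw [map_one, one_smul, cosetLength_root] at this
    omega
  · induction hk : cosetLength H c using Nat.strong_induction_on generalizing c with
    | _ k ih =>
      by_cases hc : c = root H
      · rw [hc, τ_root, one_smul]
      · rw [τ_eq c hc, mul_smul, ih _ (hk ▸ hpar c hc) _ rfl, shift_smul]

namespace CosetTree

variable {H : Subgroup (CoprodI M)} (T : CosetTree H)

lemma base_base (c : CoprodI M ⧸ H) (i : ι) : T.base (T.base c i) i = T.base c i := by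
  conv_rhs => rw [← T.shift_smul c i]
  rw [T.base_smul]

lemma inv_shift_smul (c : CoprodI M ⧸ H) (i : ι) :
    (CoprodI.of (T.shift c i) : CoprodI M)⁻¹ • c = T.base c i := by
  rw [inv_smul_eq_iff, T.shift_smul]

lemma base_parent_ne {c : CoprodI M ⧸ H} (hc : c ≠ root H) : T.base c (T.parent c) ≠ c := by
  intro h
  have := T.depth_lt c hc
  rw [h] at this
  exact lt_irrefl _ this

/-- The element of the factor by which `m` moves the base point of the orbit of `c`. -/
def holonomy (c : CoprodI M ⧸ H) (i : ι) (m : M i) : M i :=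
  (T.shift ((CoprodI.of m : CoprodI M) • c) i)⁻¹ * m * T.shift c i

lemma holonomy_smul (c : CoprodI M ⧸ H) (i : ι) (m : M i) :
    (CoprodI.of (T.holonomy c i m) : CoprodI M) • T.base c i = T.base c i := by
  rw [holonomy, map_mul, map_mul, mul_smul, mul_smul, T.shift_smul, map_inv, T.inv_shift_smul,
    T.base_smul]

lemma holonomy_mul (c : CoprodI M ⧸ H) (i : ι) (m m' : M i) :
    T.holonomy c i (m * m') =
      T.holonomy ((CoprodI.of m' : CoprodI M) • c) i m * T.holonomy c i m' := by
  simp only [holonomy, map_mul, mul_smul]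
  group

lemma holonomy_shift (c : CoprodI M ⧸ H) (i : ι) :
    T.holonomy (T.base c i) i (T.shift c i) = 1 := by
  rw [holonomy, T.shift_smul, T.shift_base _ i (T.base_base c i)]
  group

lemma holonomy_of_base {c : CoprodI M ⧸ H} {i : ι} (hc : T.base c i = c) {m : M i}
    (hm : (CoprodI.of m : CoprodI M) • c = c) : T.holonomy c i m = m := by
  rw [holonomy, hm, T.shift_base c i hc]
  group

end CosetTree

/-- A function on the `i`-th factor that is multiplicative on the stabilizer of each coset. -/
def IsMulOnStabilizers {P : Type*} [Group P] (H : Subgroup (CoprodI M))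
    (σ : CoprodI M ⧸ H → (i : ι) → M i → P) : Prop :=
  ∀ c i (m m' : M i), (CoprodI.of m : CoprodI M) • c = c → (CoprodI.of m' : CoprodI M) • c = c →
    σ c i (m * m') = σ c i m * σ c i m'

lemma IsMulOnStabilizers.map_one {P : Type*} [Group P] {H : Subgroup (CoprodI M)}
    {σ : CoprodI M ⧸ H → (i : ι) → M i → P} (hσ : IsMulOnStabilizers H σ)
    (c : CoprodI M ⧸ H) (i : ι) : σ c i 1 = 1 := by
  have := hσ c i 1 1 (by simp) (by simp)
  simpa using this

/-- A `P`-valued cocycle on the coset space of `H`. -/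
structure Cocycle (H : Subgroup (CoprodI M)) (P : Type*) [Group P] where
  toFun : CoprodI M → CoprodI M ⧸ H → P
  map_mul : ∀ g g' c, toFun (g * g') c = toFun g (g' • c) * toFun g' c

namespace Cocycle

variable {H : Subgroup (CoprodI M)} {P : Type*} [Group P] (w : Cocycle H P)

lemma map_one (c : CoprodI M ⧸ H) : w.toFun 1 c = 1 := by
  have := w.map_mul 1 1 c
  simpa using this

lemma map_inv (g : CoprodI M) (c : CoprodI M ⧸ H) :
    w.toFun g⁻¹ (g • c) = (w.toFun g c)⁻¹ := by
  rw [eq_inv_iff_mul_eq_one, ← w.map_mul, inv_mul_cancel, w.map_one]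

/-- The restriction of a cocycle to the stabilizer of the root. -/
def restrict : H →* P where
  toFun h := w.toFun h (root H)
  map_one' := w.map_one _
  map_mul' h h' := by
    rw [Subgroup.coe_mul, w.map_mul, smul_root_eq_root_iff.2 h'.2]

lemma restrict_apply (h : H) : w.restrict h = w.toFun h (root H) := rfl

end Cocycle

/-- A cocycle may be prescribed independently on the edges of the quotient graph and on the
stabilizers of base points. -/
lemma CosetTree.exists_cocycle {H : Subgroup (CoprodI M)} (T : CosetTree H) {P : Type*} [Group P]
    (σ : CoprodI M ⧸ H → (i : ι) → M i → P) (hσ : IsMulOnStabilizers H σ)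
    (t : CoprodI M ⧸ H → ι → P) :
    ∃ w : Cocycle H P, ∀ c i (m : M i), w.toFun (CoprodI.of m) c =
      t ((CoprodI.of m : CoprodI M) • c) i * σ (T.base c i) i (T.holonomy c i m) * (t c i)⁻¹ := by
  let v (i : ι) (m : M i) (c : CoprodI M ⧸ H) : P :=
    t ((CoprodI.of m : CoprodI M) • c) i * σ (T.base c i) i (T.holonomy c i m) * (t c i)⁻¹
  have v_one : ∀ i c, v i 1 c = 1 := by
    intro i c
    have h1 : T.holonomy c i 1 = 1 := by simp [CosetTree.holonomy]
    simp [v, h1, hσ.map_one]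
  have v_mul : ∀ i (m m' : M i) c,
      v i (m * m') c = v i m ((CoprodI.of m' : CoprodI M) • c) * v i m' c := by
    intro i m m' c
    simp only [v, map_mul, mul_smul, T.holonomy_mul, T.base_smul]
    rw [hσ _ i _ _ ?_ (T.holonomy_smul _ _ _)]
    · simp [mul_assoc]
    · have := T.holonomy_smul ((CoprodI.of m' : CoprodI M) • c) i m
      rwa [T.base_smul] at this
  let f (i : ι) : M i →* Function.End ((CoprodI M ⧸ H) × P) :=
    { toFun := fun m x => ((CoprodI.of m : CoprodI M) • x.1, v i m x.1 * x.2)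
      map_one' := by
        funext x
        change _ = x
        simp [v_one]
      map_mul' := by
        intro m m'
        funext x
        change _ = ((CoprodI.of m : CoprodI M) • (CoprodI.of m' : CoprodI M) • x.1,
          v i m ((CoprodI.of m' : CoprodI M) • x.1) * (v i m' x.1 * x.2))
        simp [v_mul, mul_smul, mul_assoc] }
  let F (g : CoprodI M) (x : (CoprodI M ⧸ H) × P) : (CoprodI M ⧸ H) × P := CoprodI.lift f g x
  have F_one : ∀ x, F 1 x = x := fun x => by simp only [F, map_one]; rfl
  have F_mul : ∀ g g' x, F (g * g') x = F g (F g' x) := fun g g' x => by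
    simp only [F, map_mul]; rfl
  have F_of : ∀ i (m : M i) x,
      F (CoprodI.of m) x = ((CoprodI.of m : CoprodI M) • x.1, v i m x.1 * x.2) := fun i m x => by
    simp only [F, CoprodI.lift_of]; rfl
  have hF : ∀ (g : CoprodI M) (c : CoprodI M ⧸ H) (x : P),
      F g (c, x) = (g • c, (F g (c, 1)).2 * x) := by
    intro g
    induction g using CoprodI.induction_on with
    | one => intro c x; simp [F_one]
    | of i m => intro c x; simp [F_of]
    | mul g g' hg hg' =>
      intro c x
      rw [F_mul, F_mul, hg', hg, hg' c 1, hg _ ((F g' (c, 1)).2 * 1)]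
      simp [mul_smul, mul_assoc]
  refine ⟨⟨fun g c => (F g (c, 1)).2, fun g g' c => ?_⟩, fun c i m => ?_⟩
  · rw [F_mul, hF g' c 1, hF g, mul_one]
  · simp [F_of, v]

namespace CosetTree

variable {H : Subgroup (CoprodI M)} (T : CosetTree H)

/-- The element of `H` represented by the loop through the edge `(c, i)`. -/
def loop (c : CoprodI M ⧸ H) (i : ι) : CoprodI M :=
  (T.path c)⁻¹ * CoprodI.of (T.shift c i) * T.path (T.base c i)

lemma inv_path_smul (c : CoprodI M ⧸ H) : (T.path c)⁻¹ • c = root H := by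
  rw [inv_smul_eq_iff, T.path_smul]

lemma loop_mem (c : CoprodI M ⧸ H) (i : ι) : T.loop c i ∈ H := by
  rw [← smul_root_eq_root_iff, loop, mul_smul, mul_smul, T.path_smul, T.shift_smul,
    T.inv_path_smul]

lemma conj_mem_iff (c : CoprodI M ⧸ H) (g : CoprodI M) :
    (T.path c)⁻¹ * g * T.path c ∈ H ↔ g • c = c := by
  rw [← smul_root_eq_root_iff, mul_smul, mul_smul, T.path_smul, inv_smul_eq_iff, T.path_smul]

/-- The edges outside the tree. -/
def cotree : Set ((CoprodI M ⧸ H) × ι) :=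
  {e | T.base e.1 e.2 ≠ e.1 ∧ ¬ (e.1 ≠ root H ∧ e.2 = T.parent e.1)}

/-- The base points with nontrivial stabilizer. -/
def branch : Set ((CoprodI M ⧸ H) × ι) :=
  {e | T.base e.1 e.2 = e.1 ∧ ∃ m : M e.2, m ≠ 1 ∧ (CoprodI.of m : CoprodI M) • e.1 = e.1}

lemma loop_eq_one {c : CoprodI M ⧸ H} {i : ι} (h : (c, i) ∉ T.cotree) : T.loop c i = 1 := by
  by_cases hb : T.base c i = c
  · rw [loop, hb, T.shift_base c i hb]
    simp
  · obtain ⟨hc, rfl⟩ : c ≠ root H ∧ i = T.parent c := by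
      by_contra h'
      exact h ⟨hb, h'⟩
    rw [loop, T.path_eq c hc]
    group

/-- A subgroup containing the loops and the conjugated stabilizers contains `H`. -/
lemma le_of_generators (Q : Subgroup (CoprodI M))
    (hloop : ∀ e ∈ T.cotree, T.loop e.1 e.2 ∈ Q)
    (hstab : ∀ e ∈ T.branch, ∀ m : M e.2, (CoprodI.of m : CoprodI M) • e.1 = e.1 →
      (T.path e.1)⁻¹ * CoprodI.of m * T.path e.1 ∈ Q) : H ≤ Q := by
  have hloop' : ∀ c i, T.loop c i ∈ Q := by
    intro c i
    by_cases h : (c, i) ∈ T.cotree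
    · exact hloop _ h
    · rw [T.loop_eq_one h]
      exact Q.one_mem
  have hstab' : ∀ c i, T.base c i = c → ∀ m : M i, (CoprodI.of m : CoprodI M) • c = c →
      (T.path c)⁻¹ * CoprodI.of m * T.path c ∈ Q := by
    intro c i hb m hm
    by_cases h1 : m = 1
    · simp [h1]
    · exact hstab (c, i) ⟨hb, m, h1, hm⟩ m hm
  have key : ∀ g c, (T.path (g • c))⁻¹ * g * T.path c ∈ Q := by
    intro g
    induction g using CoprodI.induction_on with
    | one => intro c; simp
    | of i m =>
      intro c
      have h := Q.mul_mem (Q.mul_mem (hloop' ((CoprodI.of m : CoprodI M) • c) i)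
        (hstab' _ i (T.base_base c i) _ (T.holonomy_smul c i m))) (Q.inv_mem (hloop' c i))
      convert h using 1
      rw [loop, loop, T.base_smul, holonomy]
      simp only [map_mul, map_inv]
      group
    | mul g g' hg hg' =>
      intro c
      have h := Q.mul_mem (hg (g' • c)) (hg' c)
      convert h using 1
      rw [mul_smul]
      group
  intro h hh
  have := key h (root H)
  rwa [smul_root_eq_root_iff.2 hh, T.path_root, inv_one, one_mul, mul_one] at this

/-- The universal property of the free product decomposition of `H`. -/
lemma exists_hom {P : Type*} [Group P]
    (σ : CoprodI M ⧸ H → (i : ι) → M i → P) (hσ : IsMulOnStabilizers H σ)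
    (t : CoprodI M ⧸ H → ι → P) (ht : ∀ c i, (c, i) ∉ T.cotree → t c i = 1) :
    ∃ ψ : H →* P, (∀ c i, ψ ⟨T.loop c i, T.loop_mem c i⟩ = t c i) ∧
      ∀ c i, T.base c i = c → ∀ (m : M i) (hm : (CoprodI.of m : CoprodI M) • c = c),
        ψ ⟨(T.path c)⁻¹ * CoprodI.of m * T.path c, (T.conj_mem_iff c _).2 hm⟩ = σ c i m := by
  obtain ⟨w, hw⟩ := T.exists_cocycle σ hσ t
  have t_base : ∀ c i, T.base c i = c → t c i = 1 := fun c i h => ht c i fun h' => h'.1 h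
  have w_shift : ∀ c i, w.toFun (CoprodI.of (T.shift c i)) (T.base c i) = t c i := by
    intro c i
    rw [hw, T.holonomy_shift, T.shift_smul, hσ.map_one, t_base _ i (T.base_base c i)]
    simp
  have w_path : ∀ c, w.toFun (T.path c) (root H) = 1 := by
    intro c
    induction hk : T.depth c using Nat.strong_induction_on generalizing c with
    | _ k ih =>
      by_cases hc : c = root H
      · rw [hc, T.path_root, w.map_one]
      · rw [T.path_eq c hc, w.map_mul, ih _ (hk ▸ T.depth_lt c hc) _ rfl, mul_one, T.path_smul,
          w_shift]
        exact ht _ _ fun h => h.2 ⟨hc, rfl⟩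
  have w_inv : ∀ c, w.toFun (T.path c)⁻¹ c = 1 := by
    intro c
    have := w.map_inv (T.path c) (root H)
    rwa [T.path_smul, w_path, inv_one] at this
  refine ⟨w.restrict, fun c i => ?_, fun c i hb m hm => ?_⟩
  · change w.toFun ((T.path c)⁻¹ * CoprodI.of (T.shift c i) * T.path (T.base c i)) _ = _
    rw [w.map_mul, w.map_mul, T.path_smul, T.shift_smul, w_inv, w_shift,
      w_path]
    simp
  · rw [w.restrict_apply, w.map_mul, w.map_mul, T.path_smul, hm, w_inv, w_path, hw, hm,
      T.holonomy_of_base hb hm, hb]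
    simp [t_base c i hb]

end CosetTree

/-- The free factors of a free product are malnormal, and no nontrivial element of one is
conjugate into another. -/
lemma conj_of_eq_of {i j : ι} {m : M i} {s : M j} {g : CoprodI M} (hs : s ≠ 1)
    (h : g * CoprodI.of m * g⁻¹ = (CoprodI.of s : CoprodI M)) :
    j = i ∧ ∃ v : M j, g = CoprodI.of v := by
  classical
  have : Nonempty ι := ⟨i⟩
  let K : Subgroup (CoprodI M) := (CoprodI.of (i := i)).range
  obtain ⟨T⟩ := nonempty_cosetTree K
  set c : CoprodI M ⧸ K := g • root K with hc
  have hsc : (CoprodI.of s : CoprodI M) • c = c := by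
    rw [hc, ← h, ← mul_smul, inv_mul_cancel_right, mul_smul,
      smul_root_eq_root_iff.2 (show CoprodI.of m ∈ K from ⟨m, rfl⟩)]
  have key : ∀ (d : CoprodI M ⧸ K) (k : ι) (u : M k), T.base d k = d →
      (CoprodI.of u : CoprodI M) • d = d → u ≠ 1 → d = root K ∧ k = i := by
    intro d k u hd hu hu1
    by_contra hne
    let τ (e : CoprodI M ⧸ K) (l : ι) (x : M l) : CoprodI M :=
      if e = root K ∧ l = i then 1 else CoprodI.of x
    obtain ⟨ψ, -, hψ⟩ := T.exists_hom τ (by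
      intro e l x y _ _
      by_cases hel : e = root K ∧ l = i
      · simp [τ, hel]
      · simp [τ, hel]) (fun _ _ => 1) (fun _ _ _ => rfl)
    have h0 : ∀ x : K, ψ x = 1 := by
      rintro ⟨_, x, rfl⟩
      have := hψ (root K) i (T.base_root i) x (smul_root_eq_root_iff.2 ⟨x, rfl⟩)
      simpa [T.path_root, τ] using this
    have h1 := hψ d k hd u hu
    rw [h0] at h1
    simp only [τ, if_neg hne] at h1
    exact hu1 (CoprodI.of_injective (i := k) (by rw [← h1, map_one]))
  have hfix := T.holonomy_smul c j s
  have hconj : T.holonomy c j s = (T.shift c j)⁻¹ * s * T.shift c j := by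
    rw [CosetTree.holonomy, hsc]
  obtain ⟨hroot, rfl⟩ := key _ j _ (T.base_base c j) hfix (by
    rw [hconj]
    intro h1
    apply hs
    simpa [mul_assoc] using congrArg (fun x => T.shift c j * x * (T.shift c j)⁻¹) h1)
  refine ⟨rfl, ?_⟩
  have h2 := T.shift_smul c j
  rw [hroot, hc] at h2
  have h3 : g⁻¹ * CoprodI.of (T.shift c j) ∈ K := by
    rw [← smul_root_eq_root_iff, mul_smul]
    conv_lhs => rw [hc, h2]
    rw [inv_smul_smul]
  obtain ⟨v, hv⟩ := h3
  refine ⟨T.shift c j * v⁻¹, ?_⟩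
  rw [map_mul, map_inv, hv]
  group

lemma mem_conjSubgroup_factor {i : ι} {g x : CoprodI M} :
    x ∈ conjSubgroup g (factorSubgroup i) ↔ ∃ m : M i, g * CoprodI.of m * g⁻¹ = x := by
  constructor
  · rintro ⟨_, ⟨m, rfl⟩, rfl⟩
    exact ⟨m, rfl⟩
  · rintro ⟨m, rfl⟩
    exact ⟨_, ⟨m, rfl⟩, rfl⟩

/-- The Kurosh decomposition attached to a coset tree with finitely many branch points and
finitely many edges outside the tree. -/
theorem CosetTree.hasKuroshRankLE {H : Subgroup (CoprodI M)} (T : CosetTree H) {k : ℕ}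
    (A B : Finset ((CoprodI M ⧸ H) × ι)) (hA : ∀ e, e ∈ A ↔ e ∈ T.branch)
    (hB : ∀ e, e ∈ B ↔ e ∈ T.cotree) (hk : A.card + B.card ≤ k) : HasKuroshRankLE H k := by
  classical
  let a : Fin A.card ≃ A := A.equivFin.symm
  let b : Fin B.card ≃ B := B.equivFin.symm
  let S (l : Fin A.card) : Subgroup (CoprodI M) :=
    conjSubgroup (T.path (a l).1.1)⁻¹ (factorSubgroup (a l).1.2) ⊓ H
  have mem_S : ∀ (e : A) (m : M e.1.2), (CoprodI.of m : CoprodI M) • e.1.1 = e.1.1 →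
      (T.path e.1.1)⁻¹ * CoprodI.of m * T.path e.1.1 ∈ S (a.symm e) := by
    intro e m hm
    simp only [S, Equiv.apply_symm_apply]
    exact ⟨mem_conjSubgroup_factor.2 ⟨m, by rw [inv_inv]⟩, (T.conj_mem_iff _ _).2 hm⟩
  let N : Fin A.card ⊕ Fin B.card → Type :=
    Sum.elim (fun l => ↥(S l)) (fun _ : Fin B.card => Multiplicative ℤ)
  let P := CoprodI N
  let inS (l : Fin A.card) : S l →* P := CoprodI.of (M := N) (i := Sum.inl l)
  let inZ (l : Fin B.card) : Multiplicative ℤ →* P := CoprodI.of (M := N) (i := Sum.inr l)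
  have inS_congr : ∀ (l l' : Fin A.card) (x : CoprodI M) (hx : x ∈ S l) (hx' : x ∈ S l'),
      l = l' → inS l ⟨x, hx⟩ = inS l' ⟨x, hx'⟩ := by
    rintro l _ x hx hx' rfl
    rfl
  let σ (c : CoprodI M ⧸ H) (i : ι) (m : M i) : P :=
    if h : (c, i) ∈ A ∧ (CoprodI.of m : CoprodI M) • c = c then
      inS (a.symm ⟨(c, i), h.1⟩)
        ⟨(T.path c)⁻¹ * CoprodI.of m * T.path c, mem_S ⟨(c, i), h.1⟩ m h.2⟩
    else 1
  have hσ : IsMulOnStabilizers H σ := by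
    intro c i m m' hm hm'
    by_cases h : (c, i) ∈ A
    · have hmm : (CoprodI.of (m * m') : CoprodI M) • c = c := by rw [map_mul, mul_smul, hm', hm]
      simp only [σ]
      rw [dif_pos ⟨h, hmm⟩, dif_pos ⟨h, hm⟩, dif_pos ⟨h, hm'⟩, ← map_mul]
      congr 1
      apply Subtype.ext
      simp only [map_mul, Subgroup.coe_mul]
      group
    · simp [σ, h]
  let t (c : CoprodI M ⧸ H) (i : ι) : P :=
    if h : (c, i) ∈ B then inZ (b.symm ⟨(c, i), h⟩) (Multiplicative.ofAdd 1) else 1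
  obtain ⟨ψ, hψt, hψσ⟩ := T.exists_hom σ hσ t (fun c i h => dif_neg (by rwa [hB]))
  let y (l : Fin B.card) : H := ⟨T.loop (b l).1.1 (b l).1.2, T.loop_mem _ _⟩
  let fS (l : Fin A.card) : S l →* H := Subgroup.inclusion inf_le_right
  let fZ (l : Fin B.card) : Multiplicative ℤ →* H := zpowersHom H (y l)
  let f (x : Fin A.card ⊕ Fin B.card) : N x →* H :=
    Sum.rec (motive := fun x => N x →* H) fS fZ x
  let θ : P →* H := CoprodI.lift f
  have θS : ∀ l x, θ (inS l x) = Subgroup.inclusion inf_le_right x := fun l x =>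
    CoprodI.lift_of (M := N) (i := Sum.inl l) f x
  have θZ : ∀ l x, θ (inZ l x) = zpowersHom H (y l) x := fun l x =>
    CoprodI.lift_of (M := N) (i := Sum.inr l) f x
  have hθψ : ∀ h, θ (ψ h) = h := by
    let Q : Subgroup H := (θ.comp ψ).eqLocus (MonoidHom.id H)
    have hQ : H ≤ Q.map H.subtype := by
      refine T.le_of_generators _ (fun e he => ?_) (fun e he m hm => ?_)
      · refine ⟨⟨_, T.loop_mem _ _⟩, ?_, rfl⟩
        change θ (ψ _) = _
        rw [hψt]
        simp only [t]
        rw [dif_pos ((hB _).2 he), θZ]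
        simp only [zpowersHom_apply, toAdd_ofAdd, zpow_one, y, Equiv.apply_symm_apply]
        rfl
      · refine ⟨⟨_, (T.conj_mem_iff _ _).2 hm⟩, ?_, rfl⟩
        change θ (ψ _) = _
        rw [hψσ _ _ he.1 m hm]
        simp only [σ]
        rw [dif_pos ⟨(hA _).2 he, hm⟩, θS]
        rfl
    intro h
    obtain ⟨h', hh', heq⟩ := hQ h.2
    obtain rfl : h' = h := Subtype.ext heq
    exact hh'
  have hψS : ∀ l (x : S l), ψ ⟨x, x.2.2⟩ = inS l x := by
    rintro l ⟨x, hx, hxH⟩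
    obtain ⟨m, rfl⟩ := mem_conjSubgroup_factor.1 hx
    have hA' := (hA _).1 (a l).2
    have hm : (CoprodI.of m : CoprodI M) • (a l).1.1 = (a l).1.1 := by
      rw [← T.conj_mem_iff]
      simpa using hxH
    have h := hψσ _ _ hA'.1 m hm
    simp only [inv_inv]
    rw [h]
    simp only [σ]
    rw [dif_pos ⟨(a l).2, hm⟩]
    exact inS_congr _ _ _ _ _ (a.symm_apply_apply l)
  have hψθ : ψ.comp θ = MonoidHom.id P := by
    refine CoprodI.ext_hom _ _ fun x => ?_
    match x with
    | .inl l =>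
      refine MonoidHom.ext fun (x : S l) => ?_
      change ψ (θ (inS l x)) = inS l x
      rw [θS]
      exact hψS l x
    | .inr l =>
      refine MonoidHom.ext_mint ?_
      change ψ (θ (inZ l (Multiplicative.ofAdd 1))) = inZ l (Multiplicative.ofAdd 1)
      rw [θZ]
      simp only [zpowersHom_apply, toAdd_ofAdd, zpow_one, y, hψt, t]
      rw [dif_pos (b l).2]
      congr 1
      exact congrArg inZ (b.symm_apply_apply l)
  refine ⟨A.card, B.card, fun l => (a l).1.2, fun l => (T.path (a l).1.1)⁻¹,
    { toFun := ψ, invFun := θ, left_inv := hθψ, right_inv := DFunLike.congr_fun hψθ,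
      map_mul' := ψ.map_mul }, hk, fun l => ?_, fun l x => ?_⟩
  · obtain ⟨hb, m, hm1, hm⟩ := (hA _).1 (a l).2
    refine ⟨⟨(T.path (a l).1.1)⁻¹ * CoprodI.of m * T.path (a l).1.1,
      mem_conjSubgroup_factor.2 ⟨m, by rw [inv_inv]⟩, (T.conj_mem_iff _ _).2 hm⟩, 1, ?_⟩
    intro h
    have h1 := congrArg Subtype.val h
    simp only [Subgroup.coe_one] at h1
    apply hm1
    apply CoprodI.of_injective (i := (a l).1.2)
    rw [map_one]
    simpa [mul_assoc] using
      congrArg (fun x => T.path (a l).1.1 * x * (T.path (a l).1.1)⁻¹) h1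
  · change ((θ (inS l x) : H) : CoprodI M) = x
    rw [θS]
    rfl

/-- A bound for the Euler characteristic, weighted by the triviality of vertex groups, of every
finite subgraph of the quotient graph: `Z` is the set of edges, and `V`, `D` contain the vertices
with trivial stabilizer. -/
def EulerBound (H : Subgroup (CoprodI M)) (N : ℕ) : Prop :=
  ∀ (T : CosetTree H) (Z D : Finset ((CoprodI M ⧸ H) × ι)) (V : Finset (CoprodI M ⧸ H)),
    root H ∈ V → (∀ e ∈ Z, e.1 ∈ V) →
    (∀ e ∈ Z, (T.base e.1 e.2, e.2) ∈ D ∨ (T.base e.1 e.2, e.2) ∈ T.branch) →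
    Z.card + 1 ≤ N + V.card + D.card

lemma CosetTree.base_mem_branch {H : Subgroup (CoprodI M)} (T : CosetTree H)
    {c : CoprodI M ⧸ H} {i : ι} {m : M i} (hm1 : m ≠ 1)
    (hm : (CoprodI.of m : CoprodI M) • c = c) : (T.base c i, i) ∈ T.branch := by
  refine ⟨T.base_base c i, T.holonomy c i m, fun h => hm1 ?_, T.holonomy_smul c i m⟩
  rw [CosetTree.holonomy, hm] at h
  simpa [mul_assoc] using congrArg (fun x => T.shift c i * x * (T.shift c i)⁻¹) h

lemma CosetTree.exists_ancestor_closed {H : Subgroup (CoprodI M)} (T : CosetTree H)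
    (A : Finset (CoprodI M ⧸ H)) : ∃ V : Finset (CoprodI M ⧸ H), A ⊆ V ∧ root H ∈ V ∧
      ∀ c ∈ V, c ≠ root H → T.base c (T.parent c) ∈ V := by
  classical
  have single : ∀ c, ∃ V : Finset (CoprodI M ⧸ H), c ∈ V ∧
      ∀ c' ∈ V, c' ≠ root H → T.base c' (T.parent c') ∈ V := by
    intro c
    induction hk : T.depth c using Nat.strong_induction_on generalizing c with
    | _ k ih =>
      by_cases hc : c = root H
      · refine ⟨{c}, by simp, fun c' h hne => ?_⟩
        rw [Finset.mem_singleton.1 h] at hne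
        exact absurd hc hne
      · obtain ⟨V, hV, hcl⟩ := ih _ (hk ▸ T.depth_lt c hc) _ rfl
        refine ⟨insert c V, Finset.mem_insert_self _ _, fun c' h hne => ?_⟩
        rcases Finset.mem_insert.1 h with rfl | h
        · exact Finset.mem_insert_of_mem hV
        · exact Finset.mem_insert_of_mem (hcl c' h hne)
  choose V hV hcl using single
  refine ⟨insert (root H) (A.biUnion V), fun c hc => ?_, Finset.mem_insert_self _ _,
    fun c hc hne => ?_⟩
  · exact Finset.mem_insert_of_mem (Finset.mem_biUnion.2 ⟨c, hc, hV c⟩)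
  · obtain ⟨a, ha, hca⟩ := Finset.mem_biUnion.1 (Finset.mem_of_mem_insert_of_ne hc hne)
    exact Finset.mem_insert_of_mem (Finset.mem_biUnion.2 ⟨a, ha, hcl a c hca hne⟩)

lemma EulerBound.card_add_card_le {H : Subgroup (CoprodI M)} {N : ℕ} (hN : EulerBound H N)
    (T : CosetTree H) {A B : Finset ((CoprodI M ⧸ H) × ι)} (hA : ∀ e ∈ A, e ∈ T.branch)
    (hB : ∀ e ∈ B, e ∈ T.cotree) : A.card + B.card ≤ N := by
  classical
  let base (e : (CoprodI M ⧸ H) × ι) : (CoprodI M ⧸ H) × ι := (T.base e.1 e.2, e.2)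
  have base_base : ∀ e, base (base e) = base e := fun e => by simp [base, T.base_base]
  obtain ⟨V, hAV, hroot, hcl⟩ := T.exists_ancestor_closed
    (A.image Prod.fst ∪ B.image Prod.fst ∪ B.image fun e => (base e).1)
  let edge (c : CoprodI M ⧸ H) : (CoprodI M ⧸ H) × ι := (c, T.parent c)
  let R := (V.erase (root H)).image edge
  let D := A ∪ B.image base ∪ R.image base
  have base_eq : ∀ e ∈ D, base e = e := by
    intro e he
    simp only [D, Finset.mem_union, Finset.mem_image] at he
    rcases he with (he | ⟨e, -, rfl⟩) | ⟨e, -, rfl⟩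
    · exact Prod.ext (hA e he).1 rfl
    · exact base_base e
    · exact base_base e
  have mem_R : ∀ e ∈ R, e.1 ≠ root H ∧ e.2 = T.parent e.1 ∧ e.1 ∈ V := by
    intro e he
    obtain ⟨c, hc, rfl⟩ := Finset.mem_image.1 he
    exact ⟨(Finset.mem_erase.1 hc).1, rfl, (Finset.mem_erase.1 hc).2⟩
  have hDR : Disjoint D R := by
    rw [Finset.disjoint_left]
    intro e hD hR
    obtain ⟨h1, h2, -⟩ := mem_R e hR
    apply T.base_parent_ne h1
    rw [← h2]
    exact congrArg Prod.fst (base_eq e hD)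
  have hDRB : Disjoint (D ∪ R) B := by
    rw [Finset.disjoint_left]
    intro e he heB
    obtain ⟨h1, h2⟩ := hB e heB
    rcases Finset.mem_union.1 he with he | he
    · exact h1 (congrArg Prod.fst (base_eq e he))
    · exact h2 ⟨(mem_R e he).1, (mem_R e he).2.1⟩
  have hAD : A ⊆ D := fun e he =>
    Finset.mem_union_left _ (Finset.mem_union_left _ he)
  have hbase : ∀ e ∈ D ∪ R ∪ B, base e ∈ D := by
    intro e he
    rcases Finset.mem_union.1 he with he | he
    · rcases Finset.mem_union.1 he with he | he
      · rwa [base_eq e he]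
      · exact Finset.mem_union_right _ (Finset.mem_image_of_mem _ he)
    · exact Finset.mem_union_left _ (Finset.mem_union_right _ (Finset.mem_image_of_mem _ he))
  have hV : ∀ e ∈ D ∪ R ∪ B, e.1 ∈ V := by
    intro e he
    simp only [D, Finset.mem_union] at he
    rcases he with (((he | he) | he) | he) | he
    · exact hAV (by simp only [Finset.mem_union, Finset.mem_image]; exact .inl (.inl ⟨e, he, rfl⟩))
    · obtain ⟨e', he', rfl⟩ := Finset.mem_image.1 he
      exact hAV (by simp only [Finset.mem_union, Finset.mem_image]; exact .inr ⟨e', he', rfl⟩)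
    · obtain ⟨e', he', rfl⟩ := Finset.mem_image.1 he
      obtain ⟨h1, h2, h3⟩ := mem_R e' he'
      simp only [base, h2]
      exact hcl _ h3 h1
    · exact (mem_R e he).2.2
    · exact hAV (by simp only [Finset.mem_union, Finset.mem_image]; exact .inl (.inr ⟨e, he, rfl⟩))
  have h := hN T (D ∪ R ∪ B) (D \ A) V hroot hV (fun e he => by
    by_cases hb : base e ∈ A
    · exact .inr (hA _ hb)
    · exact .inl (Finset.mem_sdiff.2 ⟨hbase e he, hb⟩))
  have hR : R.card = V.card - 1 := by
    rw [Finset.card_image_of_injective _ fun c c' h => congrArg Prod.fst h,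
      Finset.card_erase_of_mem hroot]
  have hVpos := Finset.card_pos.2 ⟨_, hroot⟩
  have hDA := Finset.card_sdiff_add_card_eq_card hAD
  rw [Finset.card_union_of_disjoint hDRB, Finset.card_union_of_disjoint hDR] at h
  omega

theorem EulerBound.hasKuroshRankLE [Nonempty ι] {H : Subgroup (CoprodI M)} {N : ℕ}
    (hN : EulerBound H N) : HasKuroshRankLE H N := by
  obtain ⟨T⟩ := nonempty_cosetTree H
  have hA : T.branch.Finite := by
    by_contra h
    obtain ⟨A, hA, hcard⟩ := Set.Infinite.exists_subset_card_eq h (N + 1)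
    have := hN.card_add_card_le T (A := A) (B := ∅) (fun e he => hA he) (by simp)
    omega
  have hB : T.cotree.Finite := by
    by_contra h
    obtain ⟨B, hB, hcard⟩ := Set.Infinite.exists_subset_card_eq h (N + 1)
    have := hN.card_add_card_le T (A := ∅) (B := B) (by simp) (fun e he => hB he)
    omega
  exact T.hasKuroshRankLE hA.toFinset hB.toFinset (fun e => hA.mem_toFinset)
    (fun e => hB.mem_toFinset)
    (hN.card_add_card_le T (fun e => hA.mem_toFinset.1) (fun e => hB.mem_toFinset.1))

theorem EulerBound.iInf [Nonempty ι] {K : ℕ → Subgroup (CoprodI M)} (hK : Antitone K) {N : ℕ}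
    (hN : ∀ k, EulerBound (K k) N) : EulerBound (⨅ k, K k) N := by
  classical
  intro T Z D V hroot hV hD
  let π (k : ℕ) : CoprodI M ⧸ (⨅ k, K k) → CoprodI M ⧸ K k :=
    Subgroup.quotientMapOfLE (iInf_le K k)
  have π_smul : ∀ k (g : CoprodI M) c, π k (g • c) = g • π k c := by
    intro k g c
    induction c using QuotientGroup.induction_on
    rfl
  have sep : ∀ c c', ∃ k, ∀ k' ≥ k, π k' c = π k' c' → c = c' := by
    intro c c'
    induction c using QuotientGroup.induction_on with
    | H g =>
      induction c' using QuotientGroup.induction_on with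
      | H g' =>
        by_cases h : g⁻¹ * g' ∈ ⨅ k, K k
        · exact ⟨0, fun _ _ _ => QuotientGroup.eq.2 h⟩
        · simp only [Subgroup.mem_iInf, not_forall] at h
          obtain ⟨k, hk⟩ := h
          exact ⟨k, fun k' hk' h' => absurd (hK hk' (QuotientGroup.eq.1 h')) hk⟩
  choose κ hκ using sep
  let k := (V ×ˢ V).sup fun x => κ x.1 x.2
  have hinj : ∀ c ∈ V, ∀ c' ∈ V, π k c = π k c' → c = c' := fun c hc c' hc' h =>
    hκ c c' k (Finset.le_sup (f := fun x : _ × _ => κ x.1 x.2)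
      (Finset.mk_mem_product hc hc')) h
  obtain ⟨T'⟩ := nonempty_cosetTree (K k)
  have base_eq : ∀ c i, T'.base (π k (T.base c i)) i = T'.base (π k c) i := by
    intro c i
    conv_rhs => rw [← T.shift_smul c i, π_smul, T'.base_smul]
  have h := hN k T' (Z.image fun e => (π k e.1, e.2))
    (D.image fun e => (T'.base (π k e.1) e.2, e.2)) (V.image (π k))
    (Finset.mem_image.2 ⟨_, hroot, rfl⟩) (by
      intro _ he'
      obtain ⟨e, he, rfl⟩ := Finset.mem_image.1 he'
      exact Finset.mem_image_of_mem _ (hV e he)) (by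
      intro _ he'
      obtain ⟨e, he, rfl⟩ := Finset.mem_image.1 he'
      rcases hD e he with h | ⟨-, m, hm1, hm⟩
      · exact .inl (Finset.mem_image.2 ⟨_, h, by simp only [base_eq]⟩)
      · right
        have := T'.base_mem_branch hm1 (c := π k (T.base e.1 e.2)) (by
          rw [← π_smul]
          exact congrArg (π k) hm)
        rwa [base_eq] at this)
  rw [Finset.card_image_of_injOn] at h
  · have h1 := Finset.card_image_le (s := V) (f := π k)
    have h2 := Finset.card_image_le (s := D) (f := fun e => (T'.base (π k e.1) e.2, e.2))
    omega
  · intro e he e' he' h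
    obtain ⟨h1, h2⟩ := Prod.ext_iff.1 h
    exact Prod.ext (hinj _ (hV e he) _ (hV e' he') h1) h2

/-- A nontrivial subgroup that meets the conjugates of all factors trivially, infinite cyclic
factors excepted, has a nontrivial homomorphism to the rationals. -/
lemma exists_hom_rat_ne_one [Nonempty ι] {L : Subgroup (CoprodI M)} (hL : L ≠ ⊥)
    (hM : ∀ i, (∀ (g : CoprodI M) (m : M i), g⁻¹ * CoprodI.of m * g ∈ L → m = 1) ∨
      Nonempty (M i ≃* Multiplicative ℤ)) :
    ∃ (ψ : L →* Multiplicative ℚ) (x : L), ψ x ≠ 1 := by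
  classical
  obtain ⟨T⟩ := nonempty_cosetTree L
  by_contra! hψ
  apply hL
  rw [eq_bot_iff]
  refine T.le_of_generators _ (fun e he => ?_) (fun e he m hm => ?_)
  · exfalso
    obtain ⟨ψ, hψt, -⟩ := T.exists_hom (P := Multiplicative ℚ) (fun _ _ _ => 1)
      (fun _ _ _ _ _ _ => (mul_one 1).symm)
      (fun c i => if (c, i) = e then Multiplicative.ofAdd 1 else 1) (by
        intro c i hci
        refine if_neg ?_
        rintro rfl
        exact hci he)
    have h := hψt e.1 e.2
    rw [hψ, if_pos rfl] at h
    exact zero_ne_one (congrArg Multiplicative.toAdd h)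
  · rw [Subgroup.mem_bot]
    suffices m = 1 by simp [this]
    rcases hM e.2 with h | h
    · exact h (T.path e.1) m ((T.conj_mem_iff _ _).2 hm)
    · let τ (i : ι) : M i →* Multiplicative ℚ :=
        if h : Nonempty (M i ≃* Multiplicative ℤ) then
          (AddMonoidHom.toMultiplicative (Int.castAddHom ℚ)).comp h.some.toMonoidHom
        else 1
      obtain ⟨ψ, -, hψσ⟩ := T.exists_hom (P := Multiplicative ℚ) (fun _ i m => τ i m)
        (fun _ _ _ _ _ _ => map_mul _ _ _) (fun _ _ => 1) (fun _ _ _ => rfl)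
      have h1 := hψσ e.1 e.2 he.1 m hm
      rw [hψ] at h1
      simp only [τ, dif_pos h] at h1
      have h2 : ((Multiplicative.toAdd (h.some m) : ℤ) : ℚ) = 0 :=
        (congrArg Multiplicative.toAdd h1).symm
      apply h.some.injective
      rw [map_one]
      exact congrArg Multiplicative.ofAdd (Int.cast_eq_zero.1 h2)

section Range

variable {n p : ℕ} {M : Fin n ⊕ Fin p → Type} [∀ i, Group (M i)]

lemma exists_additive_on_stabilizer (hM : ∀ j, Nonempty (M (.inr j) ≃* Multiplicative ℤ))
    {Φ : CoprodI M →* CoprodI M} (hΦ : Function.Injective Φ)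
    {J : Fin n → Fin n ⊕ Fin p} {x : Fin n → CoprodI M}
    (hJ : ∀ i (m : M (.inl i)), ∃ m' : M (J i),
      Φ (CoprodI.of m) = x i * CoprodI.of m' * (x i)⁻¹)
    (T : CosetTree Φ.range) {c : CoprodI M ⧸ Φ.range} {j : Fin n ⊕ Fin p}
    (hc : (c, j) ∈ T.branch)
    (hc' : ∀ i, (c, j) ≠ (T.base ((x i)⁻¹ • root Φ.range) (J i), J i)) :
    ∃ f : M j → ℚ, (∀ m m', (CoprodI.of m : CoprodI M) • c = c →
        (CoprodI.of m' : CoprodI M) • c = c → f (m * m') = f m + f m') ∧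
      ∃ m, (CoprodI.of m : CoprodI M) • c = c ∧ f m ≠ 0 := by
  have : Nonempty (Fin n ⊕ Fin p) := ⟨j⟩
  obtain ⟨hb, m₀, hm₀1, hm₀⟩ := hc
  simp only at hb m₀ hm₀
  set y := T.path c with hy
  let L : Subgroup (CoprodI M) :=
    { carrier := {g | ∃ s : M j, (CoprodI.of s : CoprodI M) • c = c ∧ Φ g = y⁻¹ * CoprodI.of s * y}
      one_mem' := ⟨1, by simp, by simp⟩
      mul_mem' := by
        rintro g g' ⟨s, hs, hg⟩ ⟨s', hs', hg'⟩
        exact ⟨s * s', by rw [map_mul, mul_smul, hs', hs], by rw [map_mul, hg, hg', map_mul]; group⟩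
      inv_mem' := by
        rintro g ⟨s, hs, hg⟩
        exact ⟨s⁻¹, by rw [map_inv, inv_smul_eq_iff, hs], by rw [map_inv, hg, map_inv]; group⟩ }
  have hlift : ∀ s : M j, ∃ g : L, (CoprodI.of s : CoprodI M) • c = c →
      Φ g = y⁻¹ * CoprodI.of s * y := by
    intro s
    by_cases hs : (CoprodI.of s : CoprodI M) • c = c
    · obtain ⟨g, hg⟩ := (T.conj_mem_iff c _).2 hs
      exact ⟨⟨g, s, hs, hg⟩, fun _ => hg⟩
    · exact ⟨1, fun h => absurd h hs⟩
  choose lift hlift using hlift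
  have hL : L ≠ ⊥ := by
    intro h
    have h1 := hlift m₀ hm₀
    rw [(Subgroup.mem_bot.1 (h ▸ (lift m₀).2 : (lift m₀ : CoprodI M) ∈ (⊥ : Subgroup _))),
      map_one] at h1
    apply hm₀1
    apply CoprodI.of_injective (i := j)
    rw [map_one]
    simpa [mul_assoc] using (congrArg (fun z => y * z * y⁻¹) h1).symm
  obtain ⟨ψ, z, hz⟩ := exists_hom_rat_ne_one hL (by
    rintro (i | i)
    · left
      rintro g m ⟨s, hs, hg⟩
      by_contra hm
      obtain ⟨m', hm'⟩ := hJ i m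
      have hs1 : s ≠ 1 := by
        rintro rfl
        apply hm
        apply CoprodI.of_injective (i := Sum.inl i)
        rw [map_one]
        apply hΦ
        rw [map_one]
        simp only [map_mul, map_inv, map_one, mul_one, inv_mul_cancel] at hg
        simpa [mul_assoc] using congrArg (fun z => Φ g * z * (Φ g)⁻¹) hg
      have hconj : (y * (Φ g)⁻¹ * x i) * CoprodI.of m' * (y * (Φ g)⁻¹ * x i)⁻¹ =
          (CoprodI.of s : CoprodI M) := by
        have h2 := congrArg (fun z => y * z * y⁻¹) hg
        simp only [map_mul, map_inv, hm'] at h2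
        rw [show (CoprodI.of s : CoprodI M) = y * (y⁻¹ * CoprodI.of s * y) * y⁻¹ by group, ← h2]
        group
      obtain ⟨rfl, v, hv⟩ := conj_of_eq_of hs1 hconj
      apply hc' i
      refine Prod.ext ?_ rfl
      change c = T.base ((x i)⁻¹ • root Φ.range) (J i)
      rw [← T.base_smul _ _ v, ← hv, ← mul_smul, mul_inv_cancel_right, mul_smul,
        smul_root_eq_root_iff.2 (Φ.range.inv_mem ⟨g, rfl⟩), hy, T.path_smul, hb]
    · exact .inr (hM i))
  refine ⟨fun s => Multiplicative.toAdd (ψ (lift s)), fun s s' hs hs' => ?_, ?_⟩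
  · have hmul : lift (s * s') = lift s * lift s' := by
      apply Subtype.ext
      apply hΦ
      rw [hlift _ (by rw [map_mul, mul_smul, hs', hs]), Subgroup.coe_mul, map_mul Φ,
        hlift s hs, hlift s' hs', map_mul]
      group
    simp only [hmul, map_mul, toAdd_mul]
  · obtain ⟨s, hs, hzs⟩ := z.2
    refine ⟨s, hs, ?_⟩
    have : lift s = z := Subtype.ext (hΦ (by rw [hlift s hs, hzs]))
    simp only [this]
    exact fun h => hz (congrArg Multiplicative.ofAdd h)

/-- The image of a free product under a monomorphism that sends all factors but `p` infinite cyclic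
ones to elliptic subgroups satisfies the Euler characteristic bound of its domain. -/
theorem eulerBound_range (hM : ∀ j, Nonempty (M (.inr j) ≃* Multiplicative ℤ))
    {Φ : CoprodI M →* CoprodI M} (hΦ : Function.Injective Φ)
    (hell : ∀ i : Fin n, ∃ (j : Fin n ⊕ Fin p) (x : CoprodI M), ∀ m : M (.inl i), ∃ m' : M j,
      Φ (CoprodI.of m) = x * CoprodI.of m' * x⁻¹) :
    EulerBound Φ.range (n + p) := by
  classical
  intro T Z D V hroot hV hD
  choose J x hJ using hell
  let base (e : (CoprodI M ⧸ Φ.range) × (Fin n ⊕ Fin p)) := (T.base e.1 e.2, e.2)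
  let ell : Finset ((CoprodI M ⧸ Φ.range) × (Fin n ⊕ Fin p)) :=
    Finset.univ.image fun i => (T.base ((x i)⁻¹ • root Φ.range) (J i), J i)
  have hell_card : ell.card ≤ n := Finset.card_image_le.trans (by simp)
  let B := (Z.image base).filter (· ∈ T.branch)
  have hadd : ∀ d : ↥(B \ ell), ∃ f : M d.1.2 → ℚ, (∀ m m',
      (CoprodI.of m : CoprodI M) • d.1.1 = d.1.1 → (CoprodI.of m' : CoprodI M) • d.1.1 = d.1.1 →
        f (m * m') = f m + f m') ∧
      ∃ m, (CoprodI.of m : CoprodI M) • d.1.1 = d.1.1 ∧ f m ≠ 0 := by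
    intro d
    obtain ⟨hd, hd'⟩ := Finset.mem_sdiff.1 d.2
    refine exists_additive_on_stabilizer hM hΦ hJ T (Finset.mem_filter.1 hd).2 fun i h => hd' ?_
    exact Finset.mem_image.2 ⟨i, Finset.mem_univ i, h.symm⟩
  choose f hf_add s hs hfs using hadd
  let W := (↥Z ⊕ ↥(B \ ell)) → ℚ
  let tW (c : CoprodI M ⧸ Φ.range) (i : Fin n ⊕ Fin p) : W :=
    if h : (c, i) ∈ Z then Pi.single (Sum.inl ⟨(c, i), h⟩) 1 else 0
  let σW (c : CoprodI M ⧸ Φ.range) (i : Fin n ⊕ Fin p) (m : M i) : W :=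
    if h : (c, i) ∈ B \ ell then f ⟨(c, i), h⟩ m • Pi.single (Sum.inr ⟨(c, i), h⟩) 1 else 0
  have hσ : IsMulOnStabilizers Φ.range (fun c i m => Multiplicative.ofAdd (σW c i m)) := by
    intro c i m m' hm hm'
    rw [← ofAdd_add]
    by_cases h : (c, i) ∈ B \ ell
    · simp only [σW, dif_pos h, hf_add ⟨(c, i), h⟩ m m' hm hm', add_smul]
    · simp only [σW, dif_neg h, add_zero]
  have σW_one : ∀ c i, σW c i 1 = 0 := fun c i =>
    congrArg Multiplicative.toAdd (hσ.map_one c i)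
  obtain ⟨w, hw⟩ := T.exists_cocycle _ hσ (fun c i => Multiplicative.ofAdd (tW c i))
  let u (g : CoprodI M) (c : CoprodI M ⧸ Φ.range) : W := Multiplicative.toAdd (w.toFun g c)
  have u_mul : ∀ g g' c, u (g * g') c = u g (g' • c) + u g' c := fun g g' c =>
    congrArg Multiplicative.toAdd (w.map_mul g g' c)
  have u_one : ∀ c, u 1 c = 0 := fun c => congrArg Multiplicative.toAdd (w.map_one c)
  have u_inv : ∀ g c, u g⁻¹ (g • c) = -u g c := fun g c =>
    congrArg Multiplicative.toAdd (w.map_inv g c)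
  have u_of : ∀ c i (m : M i), u (CoprodI.of m) c =
      tW ((CoprodI.of m : CoprodI M) • c) i + σW (T.base c i) i (T.holonomy c i m) - tW c i := by
    intro c i m
    rw [sub_eq_add_neg]
    exact congrArg Multiplicative.toAdd (hw c i m)
  let χ : CoprodI M →* Multiplicative W := w.restrict.comp Φ.rangeRestrict
  have χ_apply : ∀ g, Multiplicative.toAdd (χ g) = u (Φ g) (root Φ.range) := fun g => rfl
  let z (j : Fin p) : M (.inr j) := (hM j).some.symm (Multiplicative.ofAdd 1)
  let F (c : CoprodI M ⧸ Φ.range) : W := u (T.path c) (root Φ.range)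
  let X : Finset W := Finset.univ.image (fun j => Multiplicative.toAdd (χ (CoprodI.of (z j)))) ∪
    (V.erase (root Φ.range)).image F ∪ (D ∪ B).image fun d => tW d.1 d.2 - F d.1
  let U : Submodule ℚ W := Submodule.span ℚ (X : Set W)
  have χ_mem : ∀ g, Multiplicative.toAdd (χ g) ∈ U := by
    intro g
    induction g using CoprodI.induction_on with
    | one => rw [map_one]; exact U.zero_mem
    | mul g g' hg hg' => rw [map_mul, toAdd_mul]; exact U.add_mem hg hg'
    | of i m =>
      rcases i with i | j
      · obtain ⟨m', hm'⟩ := hJ i m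
        have hfix : (CoprodI.of m' : CoprodI M) • (x i)⁻¹ • root Φ.range =
            (x i)⁻¹ • root Φ.range := by
          rw [eq_inv_smul_iff, ← mul_smul, ← mul_smul, ← hm', smul_root_eq_root_iff]
          exact ⟨_, rfl⟩
        have hu : u (CoprodI.of m') ((x i)⁻¹ • root Φ.range) = 0 := by
          have h0 : σW (T.base ((x i)⁻¹ • root Φ.range) (J i)) (J i)
              (T.holonomy ((x i)⁻¹ • root Φ.range) (J i) m') = 0 := by
            refine dif_neg fun h => (Finset.mem_sdiff.1 h).2 ?_
            exact Finset.mem_image.2 ⟨i, Finset.mem_univ i, rfl⟩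
          rw [u_of, hfix, h0]
          simp
        have hx := u_inv (x i) ((x i)⁻¹ • root Φ.range)
        rw [smul_inv_smul] at hx
        rw [χ_apply, hm', u_mul, u_mul, hfix, hu, hx, add_zero, add_neg_cancel]
        exact U.zero_mem
      · have hm : m = z j ^ Multiplicative.toAdd ((hM j).some m) := by
          apply (hM j).some.injective
          rw [map_zpow, MulEquiv.apply_symm_apply, ← ofAdd_zsmul, smul_eq_mul, mul_one, ofAdd_toAdd]
        rw [hm, map_zpow, map_zpow, toAdd_zpow]
        refine zsmul_mem (Submodule.subset_span ?_) _
        simp [X]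
  have u_sub_mem : ∀ g g', g • root Φ.range = g' • root Φ.range →
      u g (root Φ.range) - u g' (root Φ.range) ∈ U := by
    intro g g' h
    have hK : g'⁻¹ * g ∈ Φ.range := by
      rw [← smul_root_eq_root_iff, mul_smul, h, inv_smul_smul]
    obtain ⟨k, hk⟩ := id hK
    have h1 := u_mul g' (g'⁻¹ * g) (root Φ.range)
    rw [mul_inv_cancel_left, smul_root_eq_root_iff.2 hK] at h1
    rw [h1, add_sub_cancel_left, ← hk, ← χ_apply]
    exact χ_mem k
  have F_mem : ∀ c ∈ V, F c ∈ U := by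
    intro c hc
    by_cases h : c = root Φ.range
    · simp only [F, h, T.path_root, u_one, U.zero_mem]
    · refine Submodule.subset_span ?_
      simp only [X, Finset.coe_union, Finset.coe_image]
      exact .inl (.inr ⟨c, by simp [h, hc], rfl⟩)
  have step : ∀ c i (m : M i),
      u (CoprodI.of m) c - (F ((CoprodI.of m : CoprodI M) • c) - F c) ∈ U := by
    intro c i m
    have h := u_sub_mem (CoprodI.of m * T.path c) (T.path ((CoprodI.of m : CoprodI M) • c))
      (by rw [mul_smul, T.path_smul, T.path_smul])
    rw [u_mul, T.path_smul] at h
    convert h using 1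
    simp only [F]
    abel
  have t_mem : ∀ e ∈ Z, tW e.1 e.2 ∈ U := by
    intro e he
    have h := step (T.base e.1 e.2) e.2 (T.shift e.1 e.2)
    rw [u_of, T.holonomy_shift, σW_one, T.shift_smul] at h
    have hbase : tW (T.base e.1 e.2) e.2 - F (T.base e.1 e.2) ∈ U := by
      refine Submodule.subset_span ?_
      simp only [X, Finset.coe_union, Finset.coe_image]
      refine .inr ⟨base e, ?_, rfl⟩
      rcases hD e he with h | h
      · exact .inl h
      · exact .inr (Finset.mem_filter.2 ⟨Finset.mem_image_of_mem _ he, h⟩)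
    have := U.add_mem (U.add_mem h hbase) (F_mem _ (hV e he))
    convert this using 1
    abel
  have single_inr_mem : ∀ d : ↥(B \ ell), (Pi.single (Sum.inr d) 1 : W) ∈ U := by
    intro d
    have hdb : T.base d.1.1 d.1.2 = d.1.1 :=
      (Finset.mem_filter.1 (Finset.mem_sdiff.1 d.2).1).2.1
    have h := step d.1.1 d.1.2 (s d)
    rw [u_of, hs d, T.holonomy_of_base hdb (hs d), hdb] at h
    have hσd : σW d.1.1 d.1.2 (s d) = f d (s d) • Pi.single (Sum.inr d) 1 := dif_pos d.2
    rw [hσd, sub_self, sub_zero, add_sub_cancel_left] at h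
    exact (U.smul_mem_iff (hfs d)).1 h
  have hU : U = ⊤ := by
    rw [eq_top_iff, ← (Pi.basisFun ℚ (↥Z ⊕ ↥(B \ ell))).span_eq, Submodule.span_le]
    rintro _ ⟨e | d, rfl⟩
    · have h := t_mem e.1 e.2
      simp only [tW, Prod.mk.eta, dif_pos e.2] at h
      simpa using h
    · simpa using single_inr_mem d
  have hrank : Z.card + (B \ ell).card ≤ X.card := by
    have h := finrank_span_finset_le_card (R := ℚ) X
    change Module.finrank ℚ U ≤ _ at h
    rw [hU, finrank_top, Module.finrank_fintype_fun_eq_card, Fintype.card_sum, Fintype.card_coe,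
      Fintype.card_coe] at h
    exact h
  have hX : X.card ≤ p + (V.card - 1) + (D.card + B.card) := by
    refine (Finset.card_union_le _ _).trans (add_le_add ((Finset.card_union_le _ _).trans
      (add_le_add (Finset.card_image_le.trans (by simp)) (Finset.card_image_le.trans ?_)))
      (Finset.card_image_le.trans (Finset.card_union_le _ _)))
    rw [Finset.card_erase_of_mem hroot]
  have hB := Finset.card_le_card_sdiff_add_card (s := B) (t := ell)
  have hVpos := Finset.card_pos.2 ⟨_, hroot⟩
  omega

end Range

lemma subsingleton_coprodI {ι : Type*} {M : ι → Type*} [∀ i, Monoid (M i)] [IsEmpty ι] :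
    Subsingleton (CoprodI M) := by
  refine subsingleton_of_forall_eq 1 fun g => ?_
  induction g using CoprodI.induction_on with
  | one => rfl
  | of i m => exact (IsEmpty.false i).elim
  | mul g g' hg hg' => rw [hg, hg', mul_one]

lemma iterHom_injective {G : Type*} [Group G] {φ : G →* G} (hφ : Function.Injective φ) (k : ℕ) :
    Function.Injective (iterHom φ k) := by
  induction k with
  | zero => exact Function.injective_id
  | succ k ih => exact hφ.comp ih

lemma iterHom_succ_eq_comp {G : Type*} [Group G] (φ : G →* G) (k : ℕ) :
    iterHom φ (k + 1) = (iterHom φ k).comp φ := by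
  induction k with
  | zero => rfl
  | succ k ih =>
    change φ.comp (iterHom φ (k + 1)) = (φ.comp (iterHom φ k)).comp φ
    rw [ih, MonoidHom.comp_assoc]

lemma antitone_range_iterHom {G : Type*} [Group G] (φ : G →* G) :
    Antitone fun k => (iterHom φ (k + 1)).range := by
  refine antitone_nat_of_succ_le fun k => ?_
  rw [iterHom_succ_eq_comp φ (k + 1)]
  rintro _ ⟨g, rfl⟩
  exact ⟨φ g, rfl⟩

end KuroshRank

/-- Let `G = G_1 * … * G_n * F`, where each `G_i` is not infinite cyclic
and `F` is a free group of finite rank `p`, and let `φ : G → G` be a symmetric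
monomorphism.  Then the stable image `φ^∞(G) = ⋂ₖ φᵏ(G)` has Kurosh rank at most
`n + p` with respect to this splitting of `G`. -/
theorem kurosh_rank_stableImage_of_symmetric_monomorphism {n p : ℕ}
    (Gf : Fin n → Type) [∀ i, Group (Gf i)]
    (hG : ∀ i, ¬ Nonempty (Gf i ≃* Multiplicative ℤ))
    (φ : CoprodI (Sum.elim Gf fun _ : Fin p => Multiplicative ℤ) →*
        CoprodI (Sum.elim Gf fun _ : Fin p => Multiplicative ℤ))
    (hinj : Function.Injective φ)
    (hsym : IsSymmetric φ) :
    HasKuroshRankLE (stableImage φ) (n + p) := by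
  rcases isEmpty_or_nonempty (Fin n ⊕ Fin p) with hι | hι
  · have : Subsingleton (CoprodI (Sum.elim Gf fun _ : Fin p => Multiplicative ℤ)) :=
      KuroshRank.subsingleton_coprodI
    have : Subsingleton (CoprodI (Sum.elim
        (fun i : Fin 0 => ↥(conjSubgroup (i.elim0 : CoprodI (Sum.elim Gf fun _ : Fin p =>
          Multiplicative ℤ)) (factorSubgroup (i.elim0 : Fin n ⊕ Fin p)) ⊓ stableImage φ))
        (fun _ : Fin 0 => Multiplicative ℤ))) := KuroshRank.subsingleton_coprodI
    refine ⟨0, 0, fun i => i.elim0, fun i => i.elim0, ?_, Nat.zero_le _, fun i => i.elim0,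
      fun i => i.elim0⟩
    exact ⟨⟨fun _ => 1, fun _ => 1, fun _ => Subsingleton.elim _ _,
      fun _ => Subsingleton.elim _ _⟩, fun _ _ => Subsingleton.elim _ _⟩
  · have hM : ∀ j : Fin p, Nonempty
        (Sum.elim Gf (fun _ : Fin p => Multiplicative ℤ) (.inr j) ≃* Multiplicative ℤ) :=
      fun j => ⟨MulEquiv.refl (Multiplicative ℤ)⟩
    have hell : ∀ i : Fin n, ∃ (j : Fin n) (x : CoprodI (Sum.elim Gf fun _ => Multiplicative ℤ)),
        ∀ m : Sum.elim Gf (fun _ : Fin p => Multiplicative ℤ) (.inl i),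
          ∃ m' : Sum.elim Gf (fun _ : Fin p => Multiplicative ℤ) (.inl j),
            φ (CoprodI.of m) = x * CoprodI.of m' * x⁻¹ := by
      intro i
      obtain ⟨j, x, hj, hle⟩ := hsym (.inl i) (hG i)
      rcases j with j | j
      · refine ⟨j, x, fun m => ?_⟩
        obtain ⟨_, ⟨m', rfl⟩, hm'⟩ := hle ⟨_, ⟨m, rfl⟩, rfl⟩
        exact ⟨m', hm'.symm⟩
      · exact absurd (hM j) hj
    have hiter : ∀ (k : ℕ) (i : Fin n), ∃ (j : Fin n)
        (x : CoprodI (Sum.elim Gf fun _ => Multiplicative ℤ)),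
        ∀ m : Sum.elim Gf (fun _ : Fin p => Multiplicative ℤ) (.inl i),
          ∃ m' : Sum.elim Gf (fun _ : Fin p => Multiplicative ℤ) (.inl j),
            iterHom φ k (CoprodI.of m) = x * CoprodI.of m' * x⁻¹ := by
      intro k i
      induction k with
      | zero => exact ⟨i, 1, fun m => ⟨m, by simp [iterHom]⟩⟩
      | succ k ih =>
        obtain ⟨j, x, hx⟩ := ih
        obtain ⟨j', x', hx'⟩ := hell j
        refine ⟨j', φ x * x', fun m => ?_⟩
        obtain ⟨m', hm'⟩ := hx m
        obtain ⟨m'', hm''⟩ := hx' m'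
        refine ⟨m'', ?_⟩
        rw [iterHom, MonoidHom.comp_apply, hm', map_mul, map_mul, map_inv, hm'']
        group
    refine (KuroshRank.EulerBound.iInf (KuroshRank.antitone_range_iterHom φ) fun k =>
      KuroshRank.eulerBound_range hM (KuroshRank.iterHom_injective hinj (k + 1))
        fun i => ?_).hasKuroshRankLE
    obtain ⟨j, h⟩ := hiter (k + 1) i
    exact ⟨.inl j, h⟩
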